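/- arXiv:0707.3164 — 2 statements merged into one kernel-verified Lean document; each statement's English description precedes it below -/
import Mathlib

section
/- With grad~ and div~ as above on flat ℝⁿ, the reordering identities grad~∘g = g∘grad~∘((𝒩+𝒞−1)/(𝒩+𝒞+1)) and tr∘div~ = ((𝒩+𝒞−1)/(𝒩+𝒞+1))∘div~∘tr hold, where the rational expressions in the commuting operators 𝒩, 𝒞 are interpreted spectrally (they act by scalars on each fiberwise isotypic component g^kΦ). -/
open MvPolynomial Finset

/-- Polynomial symmetric tensor fields on flat `ℝⁿ`: polynomials in `x` (Sum.inl)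
and auxiliary `y` (Sum.inr) variables. -/
abbrev STF (n : ℕ) := MvPolynomial (Fin n ⊕ Fin n) ℝ

/-- `grad = Σ_μ y_μ ∂/∂x^μ`. -/
noncomputable def oGrad (n : ℕ) : Module.End ℝ (STF n) :=
  ∑ μ : Fin n, (LinearMap.mulLeft ℝ (X (Sum.inr μ))) ∘ₗ (pderiv (Sum.inl μ)).toLinearMap

/-- `div = Σ_μ (∂/∂y_μ)(∂/∂x^μ)`. -/
noncomputable def oDiv (n : ℕ) : Module.End ℝ (STF n) :=
  ∑ μ : Fin n, (pderiv (Sum.inr μ)).toLinearMap ∘ₗ (pderiv (Sum.inl μ)).toLinearMap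

/-- `□ = Σ_μ ∂²/∂(x^μ)²`. -/
noncomputable def oBox (n : ℕ) : Module.End ℝ (STF n) :=
  ∑ μ : Fin n, (pderiv (Sum.inl μ)).toLinearMap ∘ₗ (pderiv (Sum.inl μ)).toLinearMap

/-- Fiberwise Euler operator `N = Σ_μ y_μ ∂/∂y_μ`. -/
noncomputable def oNy (n : ℕ) : Module.End ℝ (STF n) :=
  ∑ μ : Fin n, (LinearMap.mulLeft ℝ (X (Sum.inr μ))) ∘ₗ (pderiv (Sum.inr μ)).toLinearMap

/-- Fiberwise multiplication `g = (Σ_μ y_μ²)·`. -/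
noncomputable def oGy (n : ℕ) : Module.End ℝ (STF n) :=
  LinearMap.mulLeft ℝ (∑ μ : Fin n, X (Sum.inr μ) ^ 2)

/-- Fiberwise trace `tr = Σ_μ ∂²/∂y_μ²`. -/
noncomputable def oTry (n : ℕ) : Module.End ℝ (STF n) :=
  ∑ μ : Fin n, (pderiv (Sum.inr μ)).toLinearMap ∘ₗ (pderiv (Sum.inr μ)).toLinearMap

namespace STF

variable {n : ℕ}

lemma oGrad_apply (f : STF n) :
    oGrad n f = ∑ μ : Fin n, X (Sum.inr μ) * pderiv (Sum.inl μ) f := by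
  simp [oGrad]

lemma oDiv_apply (f : STF n) :
    oDiv n f = ∑ μ : Fin n, pderiv (Sum.inr μ) (pderiv (Sum.inl μ) f) := by
  simp [oDiv]

lemma oNy_apply (f : STF n) :
    oNy n f = ∑ μ : Fin n, X (Sum.inr μ) * pderiv (Sum.inr μ) f := by
  simp [oNy]

lemma oTry_apply (f : STF n) :
    oTry n f = ∑ μ : Fin n, pderiv (Sum.inr μ) (pderiv (Sum.inr μ) f) := by
  simp [oTry]

lemma oGy_apply (f : STF n) :
    oGy n f = (∑ μ : Fin n, X (Sum.inr μ) ^ 2) * f := by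
  simp [oGy]

lemma pderiv_pderiv_comm (i j : Fin n ⊕ Fin n) (f : STF n) :
    pderiv i (pderiv j f) = pderiv j (pderiv i f) := by
  have h : ⁅pderiv (R := ℝ) i, pderiv (R := ℝ) j⁆ = 0 := by
    refine MvPolynomial.derivation_ext (R := ℝ) fun k => ?_
    simp only [Derivation.commutator_apply, pderiv_X, Pi.single_apply, apply_ite (pderiv (R := ℝ) _),
      map_zero, Derivation.map_one_eq_zero, ite_self, sub_self, Derivation.zero_apply]
  have := congrArg (fun D : Derivation ℝ (STF n) (STF n) => D f) h
  simpa [Derivation.commutator_apply, sub_eq_zero] using this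

lemma pderiv_inl_oGy (μ : Fin n) (f : STF n) :
    pderiv (Sum.inl μ) (oGy n f) = oGy n (pderiv (Sum.inl μ) f) := by
  simp [oGy_apply, pderiv_X, Derivation.leibniz_pow]

lemma pderiv_inr_oGy (μ : Fin n) (f : STF n) :
    pderiv (Sum.inr μ) (oGy n f)
      = 2 * X (Sum.inr μ) * f + oGy n (pderiv (Sum.inr μ) f) := by
  simp [oGy_apply, pderiv_X, Derivation.leibniz_pow, Pi.single_apply]
  ring

lemma pderiv_inr_oGrad (μ : Fin n) (f : STF n) :
    pderiv (Sum.inr μ) (oGrad n f)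
      = pderiv (Sum.inl μ) f + oGrad n (pderiv (Sum.inr μ) f) := by
  simp [oGrad_apply, pderiv_X, Pi.single_apply, Finset.sum_add_distrib,
    pderiv_pderiv_comm (Sum.inr μ), add_comm]

lemma pderiv_inr_oNy (μ : Fin n) (f : STF n) :
    pderiv (Sum.inr μ) (oNy n f)
      = pderiv (Sum.inr μ) f + oNy n (pderiv (Sum.inr μ) f) := by
  simp [oNy_apply, pderiv_X, Pi.single_apply, Finset.sum_add_distrib,
    pderiv_pderiv_comm (Sum.inr μ), add_comm]

lemma oGrad_oGy (f : STF n) : oGrad n (oGy n f) = oGy n (oGrad n f) := by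
  simp only [oGrad_apply, pderiv_inl_oGy, map_sum]
  refine Finset.sum_congr rfl fun μ _ => ?_
  simp only [oGy_apply]
  ring

lemma oDiv_oGy (f : STF n) :
    oDiv n (oGy n f) = oGy n (oDiv n f) + (2 : ℝ) • oGrad n f := by
  simp only [oDiv_apply, pderiv_inl_oGy, pderiv_inr_oGy, Finset.sum_add_distrib, map_sum,
    oGrad_apply, Finset.smul_sum, ofNat_smul_eq_nsmul, nsmul_eq_mul, Nat.cast_ofNat, mul_assoc]
  rw [add_comm]

lemma oNy_oGy (f : STF n) :
    oNy n (oGy n f) = oGy n (oNy n f) + (2 : ℝ) • oGy n f := by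
  simp only [oNy_apply, pderiv_inr_oGy, ofNat_smul_eq_nsmul, nsmul_eq_mul, Nat.cast_ofNat]
  rw [map_sum, oGy_apply f, Finset.sum_mul, Finset.mul_sum, ← Finset.sum_add_distrib]
  refine Finset.sum_congr rfl fun μ _ => ?_
  simp only [oGy_apply]
  ring

lemma oTry_oGy (f : STF n) :
    oTry n (oGy n f) = oGy n (oTry n f) + (4 : ℝ) • oNy n f + (2 * n : ℝ) • f := by
  have h : ∀ μ : Fin n, pderiv (Sum.inr μ) (pderiv (Sum.inr μ) (oGy n f))
      = oGy n (pderiv (Sum.inr μ) (pderiv (Sum.inr μ) f))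
        + (4 : ℝ) • (X (Sum.inr μ) * pderiv (Sum.inr μ) f) + (2 : ℝ) • f := by
    intro μ
    have h2 : pderiv (Sum.inr μ) (2 : STF n) = 0 := by
      simpa using (pderiv (R := ℝ) (Sum.inr μ : Fin n ⊕ Fin n)).map_natCast 2
    simp only [pderiv_inr_oGy, map_add, Derivation.leibniz, h2, pderiv_X_self, smul_eq_mul,
      ofNat_smul_eq_nsmul, nsmul_eq_mul, Nat.cast_ofNat]
    ring
  simp only [oTry_apply, h, Finset.sum_add_distrib, map_sum, oNy_apply, Finset.smul_sum]
  rw [Finset.sum_const, Finset.card_univ, Fintype.card_fin, ← Nat.cast_smul_eq_nsmul ℝ, smul_smul,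
    mul_comm (n : ℝ)]

lemma oTry_oGrad (f : STF n) :
    oTry n (oGrad n f) = oGrad n (oTry n f) + (2 : ℝ) • oDiv n f := by
  simp only [oTry_apply, pderiv_inr_oGrad, map_add, Finset.sum_add_distrib, map_sum, oDiv_apply,
    pderiv_pderiv_comm (Sum.inl _) (Sum.inr _), two_smul]
  abel

lemma oTry_oNy (f : STF n) :
    oTry n (oNy n f) = oNy n (oTry n f) + (2 : ℝ) • oTry n f := by
  simp only [oTry_apply, pderiv_inr_oNy, map_add, Finset.sum_add_distrib, map_sum, two_smul]
  abel

lemma oTry_oDiv (f : STF n) : oTry n (oDiv n f) = oDiv n (oTry n f) := by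
  simp only [oTry_apply, oDiv_apply, map_sum]
  rw [Finset.sum_comm]
  refine Finset.sum_congr rfl fun μ _ => Finset.sum_congr rfl fun ν _ => ?_
  rw [pderiv_pderiv_comm (Sum.inr μ) (Sum.inr ν), pderiv_pderiv_comm (Sum.inr μ) (Sum.inl ν),
    pderiv_pderiv_comm (Sum.inr μ) (Sum.inr ν), pderiv_pderiv_comm (Sum.inr μ) (Sum.inl ν)]

lemma oNy_monomial (m : (Fin n ⊕ Fin n) →₀ ℕ) (a : ℝ) :
    oNy n (monomial m a) = ((∑ μ : Fin n, m (Sum.inr μ) : ℕ) : ℝ) • monomial m a := by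
  simp only [oNy_apply, X_mul_pderiv_monomial]
  rw [← Finset.sum_smul, Nat.cast_smul_eq_nsmul]

lemma coeff_oNy (m : (Fin n ⊕ Fin n) →₀ ℕ) (f : STF n) :
    coeff m (oNy n f) = ((∑ μ : Fin n, m (Sum.inr μ) : ℕ) : ℝ) * coeff m f := by
  induction f using MvPolynomial.induction_on' with
  | monomial u a =>
    rw [oNy_monomial, coeff_smul, coeff_monomial]
    split_ifs with h
    · subst h; rfl
    · simp
  | add p q hp hq => rw [map_add, coeff_add, hp, hq, coeff_add, mul_add]

lemma eq_zero_of_oNy_eq_neg {c : ℝ} (hc : c < 0) {f : STF n} (hf : oNy n f = c • f) :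
    f = 0 := by
  ext m
  have h := coeff_oNy m f
  rw [hf, coeff_smul, smul_eq_mul] at h
  have h0 : (0 : ℝ) ≤ ((∑ μ : Fin n, m (Sum.inr μ) : ℕ) : ℝ) := Nat.cast_nonneg _
  rw [coeff_zero]
  by_contra hne
  exact absurd (mul_right_cancel₀ hne h) (by linarith)

lemma oNy_oTry {c : ℝ} {f : STF n} (hf : oNy n f = c • f) :
    oNy n (oTry n f) = (c - 2) • oTry n f := by
  have h := oTry_oNy f
  rw [hf, map_smul] at h
  rw [sub_smul, h, add_sub_cancel_right]

lemma oNy_oGy_pow {c : ℝ} {f : STF n} (hf : oNy n f = c • f) (k : ℕ) :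
    oNy n ((oGy n ^ k) f) = (c + 2 * k) • (oGy n ^ k) f := by
  induction k with
  | zero => simpa using hf
  | succ k ih =>
    rw [pow_succ', Module.End.mul_apply, oNy_oGy, ih, map_smul, ← add_smul]
    congr 1
    push_cast
    ring

lemma oTry_oGy_pow_succ {c : ℝ} {f : STF n} (hf : oNy n f = c • f) (h0 : oTry n f = 0)
    (k : ℕ) :
    oTry n ((oGy n ^ (k + 1)) f) = (2 * (k + 1) * (2 * c + n + 2 * k) : ℝ) • (oGy n ^ k) f := by
  induction k with
  | zero =>
    rw [zero_add, pow_one, oTry_oGy, h0, hf, map_zero, zero_add, smul_smul, ← add_smul, pow_zero,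
      Module.End.one_apply]
    congr 1
    push_cast
    ring
  | succ k ih =>
    rw [pow_succ', Module.End.mul_apply, oTry_oGy, ih, oNy_oGy_pow hf, map_smul,
      ← Module.End.mul_apply, ← pow_succ', smul_smul, ← add_smul, ← add_smul]
    congr 1
    push_cast
    ring

/-- The span of the `g ^ k φ` of total `y`-degree `s`, with `φ` harmonic in `y`. -/
noncomputable def harmonicSpan (n s : ℕ) : Submodule ℝ (STF n) :=
  Submodule.span ℝ {p | ∃ (j k : ℕ) (φ : STF n), j + 2 * k = s ∧ oNy n φ = (j : ℝ) • φ ∧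
    oTry n φ = 0 ∧ p = (oGy n ^ k) φ}

lemma exists_oTry_eq (hn : 0 < n) {s : ℕ} {p : STF n} (hp : p ∈ harmonicSpan n s) :
    ∃ q ∈ harmonicSpan n (s + 2), oNy n q = ((s + 2 : ℕ) : ℝ) • q ∧ oTry n q = p := by
  induction hp using Submodule.span_induction with
  | mem p hp =>
    obtain ⟨j, k, φ, hs, hφ, h0, rfl⟩ := hp
    have hc : (2 * (k + 1) * (2 * j + n + 2 * k) : ℝ) ≠ 0 := by positivity
    refine ⟨(2 * (k + 1) * (2 * j + n + 2 * k) : ℝ)⁻¹ • (oGy n ^ (k + 1)) φ, ?_, ?_, ?_⟩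
    · exact Submodule.smul_mem _ _
        (Submodule.subset_span ⟨j, k + 1, φ, by omega, hφ, h0, rfl⟩)
    · rw [map_smul, oNy_oGy_pow hφ, smul_comm, ← hs]
      congr 2
      push_cast
      ring
    · rw [map_smul, oTry_oGy_pow_succ hφ h0, inv_smul_smul₀ hc]
  | zero => exact ⟨0, zero_mem _, by simp, by simp⟩
  | add p q _ _ hp hq =>
    obtain ⟨a, ha, ha', rfl⟩ := hp
    obtain ⟨b, hb, hb', rfl⟩ := hq
    exact ⟨a + b, add_mem ha hb, by rw [map_add, ha', hb', smul_add], map_add _ _ _⟩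
  | smul c p _ hp =>
    obtain ⟨a, ha, ha', rfl⟩ := hp
    exact ⟨c • a, Submodule.smul_mem _ _ ha, by rw [map_smul, ha', smul_comm], map_smul _ _ _⟩

/-- Fischer decomposition in the `y` variables, for fixed `y`-degree. -/
lemma mem_harmonicSpan (hn : 0 < n) (s : ℕ) {p : STF n} (hp : oNy n p = (s : ℝ) • p) :
    p ∈ harmonicSpan n s := by
  induction s using Nat.strong_induction_on generalizing p with
  | _ s ih =>
    have harm : ∀ φ : STF n, oNy n φ = (s : ℝ) • φ → oTry n φ = 0 → φ ∈ harmonicSpan n s :=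
      fun φ hφ h0 => Submodule.subset_span ⟨s, 0, φ, by simp, hφ, h0, by simp⟩
    have htr := oNy_oTry hp
    rcases Nat.lt_or_ge s 2 with hs | hs
    · have hs' : (s : ℝ) < 2 := by exact_mod_cast hs
      exact harm p hp (eq_zero_of_oNy_eq_neg (by linarith) htr)
    · obtain ⟨t, rfl⟩ := Nat.exists_eq_add_of_le' hs
      obtain ⟨q, hq, hq', hqp⟩ := exists_oTry_eq hn
        (ih t (by omega) (p := oTry n p) (by simpa using htr))
      have h := harm (p - q) (by rw [map_sub, hp, hq', smul_sub]) (by rw [map_sub, hqp, sub_self])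
      simpa using add_mem h hq

/-- Two linear maps agreeing on all `g ^ k φ`, with `φ` homogeneous and harmonic in `y`,
are equal. -/
lemma hom_ext_of_harmonic (hn : 0 < n) {M : Type*} [AddCommGroup M] [Module ℝ M]
    {A B : STF n →ₗ[ℝ] M}
    (h : ∀ (s k : ℕ) (φ : STF n), oNy n φ = (s : ℝ) • φ → oTry n φ = 0 →
      A ((oGy n ^ k) φ) = B ((oGy n ^ k) φ)) : A = B := by
  have key : ∀ s, harmonicSpan n s ≤ LinearMap.eqLocus A B := by
    refine fun s => Submodule.span_le.2 ?_
    rintro _ ⟨j, k, φ, -, hφ, h0, rfl⟩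
    exact h j k φ hφ h0
  ext1 m
  ext
  exact key _ (mem_harmonicSpan hn _ (oNy_monomial m 1))

lemma mul_oGy_comm (hn : 0 < n) {C : Module.End ℝ (STF n)}
    (hC : ∀ (s k : ℕ) (φ : STF n), oNy n φ = (s : ℝ) • φ → oTry n φ = 0 →
      C ((oGy n ^ k) φ) = ((s : ℝ) + ((n : ℝ) - 2) / 2) • (oGy n ^ k) φ) :
    C * oGy n = oGy n * C := by
  refine hom_ext_of_harmonic hn fun s k φ hφ h0 => ?_
  have h := hC s (k + 1) φ hφ h0
  rw [pow_succ', Module.End.mul_apply] at h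
  rw [Module.End.mul_apply, Module.End.mul_apply, hC s k φ hφ h0, map_smul, h]

lemma mul_oTry_comm (hn : 0 < n) {C : Module.End ℝ (STF n)}
    (hC : ∀ (s k : ℕ) (φ : STF n), oNy n φ = (s : ℝ) • φ → oTry n φ = 0 →
      C ((oGy n ^ k) φ) = ((s : ℝ) + ((n : ℝ) - 2) / 2) • (oGy n ^ k) φ) :
    C * oTry n = oTry n * C := by
  refine hom_ext_of_harmonic hn fun s k φ hφ h0 => ?_
  rw [Module.End.mul_apply, Module.End.mul_apply, hC s k φ hφ h0, map_smul]
  cases k with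
  | zero => simp [h0]
  | succ k => rw [oTry_oGy_pow_succ hφ h0, map_smul, hC s k φ hφ h0, smul_comm]

end STF

/-- Reordering of `grad - g div E` with `g`, in an arbitrary ring. -/
lemma reorder_grad {R : Type*} [Ring R] {G D g A E E2 : R}
    (hA : A * g = g * A + 2 * g) (hG : G * g = g * G) (hD : D * g = g * D + 2 * G)
    (hE : E * (A - 1) = 1) (hE2 : (A + 1) * E2 = 1) :
    (G - g * D * E) * g = g * (G - g * D * E) * ((A - 1) * E2) := by
  have hg : E * g = g * E2 := by
    have h : (A - 1) * g = g * (A + 1) := by rw [sub_mul, hA]; noncomm_ring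
    calc E * g = E * (g * (A + 1)) * E2 := by simp only [mul_assoc, hE2, mul_one]
      _ = g * E2 := by rw [← h, ← mul_assoc, hE, one_mul]
  have h1 : (G - g * D * E) * g = g * (G * ((A + 1) * E2)) - g * (D * g) * E2 := by
    rw [hE2, sub_mul, mul_assoc _ E, hg, hG]; noncomm_ring
  have h2 : g * (G - g * D * E) * ((A - 1) * E2)
      = g * (G * (A - 1)) * E2 - g * g * D * (E * (A - 1)) * E2 := by noncomm_ring
  rw [h1, h2, hE, hD]
  noncomm_ring

/-- Reordering of `div - E grad tr` with `tr`, in an arbitrary ring. -/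
lemma reorder_div {R : Type*} [Ring R] {G D t A E E2 : R}
    (hA : t * A = A * t + 2 * t) (hG : t * G = G * t + 2 * D) (hD : t * D = D * t)
    (hE : (A - 1) * E = 1) (hE2 : (A + 1) * E2 = 1) (hE2' : E2 * (A + 1) = 1) :
    t * (D - E * G * t) = (A - 1) * E2 * (D - E * G * t) * t := by
  have ht : t * E = E2 * t := by
    have h : t * (A - 1) = (A + 1) * t := by rw [mul_sub, hA]; noncomm_ring
    calc t * E = E2 * ((A + 1) * t) * E := by rw [← mul_assoc, hE2', one_mul]
      _ = E2 * t := by rw [← h, mul_assoc, mul_assoc, hE, mul_one]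
  have hc : (A - 1) * E2 = E2 * (A - 1) := by
    have h : A * E2 + E2 = E2 * A + E2 := by
      simpa [add_mul, mul_add] using hE2.trans hE2'.symm
    rw [sub_mul, mul_sub, add_right_cancel h, one_mul, mul_one]
  have h1 : t * (D - E * G * t) = E2 * (A + 1) * D * t - E2 * (t * G) * t := by
    rw [hE2', mul_sub, hD, ← mul_assoc, ← mul_assoc, ht]; noncomm_ring
  have h2 : E2 * (A - 1) * (D - E * G * t) * t
      = E2 * (A - 1) * D * t - E2 * ((A - 1) * E) * G * t * t := by noncomm_ring
  rw [h1, hc, h2, hE, hG]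
  noncomm_ring

/-- the reordering identities
`grad~∘g = g∘grad~∘((𝒩+𝒞−1)/(𝒩+𝒞+1))` and `tr∘div~ = ((𝒩+𝒞−1)/(𝒩+𝒞+1))∘div~∘tr`,
the rational expression being realized via the inverse `E₂` of `𝒩+𝒞+1`. -/
theorem stmt15 (n : ℕ) (hn : 2 ≤ n)
    (C E E2 : Module.End ℝ (STF n))
    (hC : ∀ (s k : ℕ) (φ : STF n), oNy n φ = (s : ℝ) • φ → oTry n φ = 0 →
      C ((oGy n ^ k) φ) = ((s : ℝ) + ((n : ℝ) - 2) / 2) • (oGy n ^ k) φ)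
    (hE : (oNy n + ((n : ℝ) / 2) • 1 + C - 1) * E = 1 ∧
          E * (oNy n + ((n : ℝ) / 2) • 1 + C - 1) = 1)
    (hE2 : (oNy n + ((n : ℝ) / 2) • 1 + C + 1) * E2 = 1 ∧
           E2 * (oNy n + ((n : ℝ) / 2) • 1 + C + 1) = 1) :
    let NN : Module.End ℝ (STF n) := oNy n + ((n : ℝ) / 2) • 1
    let gradT : Module.End ℝ (STF n) := oGrad n - oGy n * oDiv n * E
    let divT : Module.End ℝ (STF n) := oDiv n - E * oGrad n * oTry n
    gradT * oGy n = oGy n * gradT * ((NN + C - 1) * E2) ∧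
    oTry n * divT = ((NN + C - 1) * E2) * divT * oTry n := by
  have hn0 : 0 < n := by omega
  have two_mul_apply : ∀ (T : Module.End ℝ (STF n)) (f : STF n), (2 * T) f = (2 : ℝ) • T f :=
    fun T f => by rw [two_mul, LinearMap.add_apply, two_smul]
  have hCg : ∀ f, C (oGy n f) = oGy n (C f) := LinearMap.congr_fun (STF.mul_oGy_comm hn0 hC)
  have hCt : ∀ f, C (oTry n f) = oTry n (C f) := LinearMap.congr_fun (STF.mul_oTry_comm hn0 hC)
  refine ⟨reorder_grad ?_ ?_ ?_ hE.2 hE2.1, reorder_div ?_ ?_ ?_ hE.1 hE2.1 hE2.2⟩ <;>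
    refine LinearMap.ext fun f => ?_ <;>
    simp only [Module.End.mul_apply, LinearMap.add_apply, two_mul_apply, LinearMap.smul_apply,
      Module.End.one_apply, map_add, map_smul, hCg, hCt, STF.oNy_oGy, STF.oGrad_oGy, STF.oDiv_oGy,
      STF.oTry_oNy, STF.oTry_oGrad, STF.oTry_oDiv]
  all_goals abel
end

section
/- With grad~ and div~ as above on flat ℝⁿ, the further reordering identities tr∘grad~ = ((𝒩+𝒞+1)(𝒩+𝒞−3)/(𝒩+𝒞−1)²)∘grad~∘tr and div~∘g = g∘div~∘((𝒩+𝒞+1)(𝒩+𝒞−3)/(𝒩+𝒞−1)²) hold (rational expressions in the commuting operators 𝒩, 𝒞 interpreted spectrally on fiberwise isotypic components). -/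
open MvPolynomial Finset

section FiberOperators

variable {n : ℕ}

theorem pderiv_pderiv_comm (i j : Fin n ⊕ Fin n) (p : STF n) :
    pderiv i (pderiv j p) = pderiv j (pderiv i p) := by
  have h : ⁅(pderiv i : Derivation ℝ (STF n) (STF n)),
      (pderiv j : Derivation ℝ (STF n) (STF n))⁆ = 0 := by
    refine MvPolynomial.derivation_ext fun k => ?_
    simp only [Derivation.commutator_apply, pderiv_X, Derivation.coe_zero, Pi.zero_apply]
    simp only [Pi.single_apply]
    split_ifs <;> simp
  have := congrArg (fun D : Derivation ℝ (STF n) (STF n) => D p) h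
  simpa [Derivation.commutator_apply, sub_eq_zero] using this

theorem oGrad_apply (p : STF n) :
    oGrad n p = ∑ μ, X (Sum.inr μ) * pderiv (Sum.inl μ) p := by
  simp [oGrad, LinearMap.sum_apply]

theorem oDiv_apply (p : STF n) :
    oDiv n p = ∑ μ, pderiv (Sum.inr μ) (pderiv (Sum.inl μ) p) := by
  simp [oDiv, LinearMap.sum_apply]

theorem oNy_apply (p : STF n) :
    oNy n p = ∑ μ, X (Sum.inr μ) * pderiv (Sum.inr μ) p := by
  simp [oNy, LinearMap.sum_apply]

theorem oGy_apply (p : STF n) : oGy n p = (∑ μ, X (Sum.inr μ) ^ 2) * p := by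
  simp [oGy]

theorem oTry_apply (p : STF n) :
    oTry n p = ∑ μ, pderiv (Sum.inr μ) (pderiv (Sum.inr μ) p) := by
  simp [oTry, LinearMap.sum_apply]

theorem pderiv_inr_oGy (ν : Fin n) (p : STF n) :
    pderiv (Sum.inr ν) (oGy n p)
      = (2 : ℝ) • (X (Sum.inr ν) * p) + oGy n (pderiv (Sum.inr ν) p) := by
  have h : pderiv (Sum.inr ν) (∑ μ : Fin n, (X (Sum.inr μ) : STF n) ^ 2) = 2 * X (Sum.inr ν) := by
    simp [map_sum, pderiv_X, Pi.single_apply, Derivation.leibniz_pow]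
  rw [oGy_apply, oGy_apply, Derivation.leibniz, h, ofNat_smul_eq_nsmul]
  simp only [smul_eq_mul, nsmul_eq_mul]
  push_cast
  ring

theorem pderiv_inl_oGy (ν : Fin n) (p : STF n) :
    pderiv (Sum.inl ν) (oGy n p) = oGy n (pderiv (Sum.inl ν) p) := by
  have h : pderiv (Sum.inl ν) (∑ μ : Fin n, (X (Sum.inr μ) : STF n) ^ 2) = 0 := by
    simp [map_sum, pderiv_X, Derivation.leibniz_pow]
  rw [oGy_apply, oGy_apply, Derivation.leibniz, h]
  simp

theorem pderiv_inr_oGrad (ν : Fin n) (p : STF n) :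
    pderiv (Sum.inr ν) (oGrad n p)
      = pderiv (Sum.inl ν) p + oGrad n (pderiv (Sum.inr ν) p) := by
  simp only [oGrad_apply, map_sum, Derivation.leibniz, smul_eq_mul, sum_add_distrib, pderiv_X,
    Pi.single_apply, Sum.inr.injEq, mul_ite, mul_one, mul_zero, sum_ite_eq', mem_univ,
    if_true]
  rw [add_comm]
  simp only [pderiv_pderiv_comm (Sum.inr ν)]

theorem pderiv_inr_oNy (ν : Fin n) (p : STF n) :
    pderiv (Sum.inr ν) (oNy n p)
      = pderiv (Sum.inr ν) p + oNy n (pderiv (Sum.inr ν) p) := by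
  simp only [oNy_apply, map_sum, Derivation.leibniz, smul_eq_mul, sum_add_distrib, pderiv_X,
    Pi.single_apply, Sum.inr.injEq, mul_ite, mul_one, mul_zero, sum_ite_eq', mem_univ,
    if_true]
  rw [add_comm]
  simp only [pderiv_pderiv_comm (Sum.inr ν)]

theorem pderiv_inl_oNy (ν : Fin n) (p : STF n) :
    pderiv (Sum.inl ν) (oNy n p) = oNy n (pderiv (Sum.inl ν) p) := by
  simp [oNy_apply, map_sum, pderiv_X, pderiv_pderiv_comm (Sum.inl ν)]

theorem oNy_X_mul (ν : Fin n) (p : STF n) :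
    oNy n (X (Sum.inr ν) * p) = X (Sum.inr ν) * p + X (Sum.inr ν) * oNy n p := by
  simp only [oNy_apply, Derivation.leibniz, smul_eq_mul, mul_add, sum_add_distrib, pderiv_X,
    Pi.single_apply, Sum.inr.injEq, mul_ite, mul_one, mul_zero, sum_ite_eq, mem_univ,
    if_true, mul_sum]
  rw [add_comm]
  congr 1
  exact sum_congr rfl fun _ _ => by ring

theorem oTry_oGy (p : STF n) :
    oTry n (oGy n p) = oGy n (oTry n p) + (4 : ℝ) • oNy n p + (2 * n : ℝ) • p := by
  have h : ∀ μ : Fin n, pderiv (Sum.inr μ) (pderiv (Sum.inr μ) (oGy n p))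
      = oGy n (pderiv (Sum.inr μ) (pderiv (Sum.inr μ) p))
        + (4 : ℝ) • (X (Sum.inr μ) * pderiv (Sum.inr μ) p) + (2 : ℝ) • p := fun μ => by
    rw [pderiv_inr_oGy, map_add, pderiv_inr_oGy, Derivation.map_smul, Derivation.leibniz,
      pderiv_X_self]
    simp only [smul_eq_mul, mul_one]
    module
  simp only [oTry_apply, h, oNy_apply, map_sum, sum_add_distrib, smul_sum, sum_const, card_univ,
    Fintype.card_fin, ← Nat.cast_smul_eq_nsmul ℝ, smul_smul, mul_comm]

theorem oTry_oGrad (p : STF n) :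
    oTry n (oGrad n p) = oGrad n (oTry n p) + (2 : ℝ) • oDiv n p := by
  simp only [oTry_apply, pderiv_inr_oGrad, map_add, map_sum, oDiv_apply, sum_add_distrib, two_smul,
    pderiv_pderiv_comm (Sum.inl _) (Sum.inr _)]
  abel

theorem oDiv_oGy (p : STF n) :
    oDiv n (oGy n p) = oGy n (oDiv n p) + (2 : ℝ) • oGrad n p := by
  simp only [oDiv_apply, pderiv_inl_oGy, pderiv_inr_oGy, map_sum, oGrad_apply, sum_add_distrib,
    smul_sum]
  abel

theorem oTry_oDiv (p : STF n) : oTry n (oDiv n p) = oDiv n (oTry n p) := by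
  simp only [oDiv_apply, oTry_apply, map_sum]
  rw [sum_comm]
  refine sum_congr rfl fun μ _ => sum_congr rfl fun ν _ => ?_
  rw [pderiv_pderiv_comm (Sum.inr μ) (Sum.inr ν), pderiv_pderiv_comm (Sum.inr μ) (Sum.inr ν),
    pderiv_pderiv_comm (Sum.inr μ) (Sum.inl ν), pderiv_pderiv_comm (Sum.inr μ) (Sum.inl ν)]

theorem oGrad_oGy (p : STF n) : oGrad n (oGy n p) = oGy n (oGrad n p) := by
  simp only [oGrad_apply, pderiv_inl_oGy, map_sum]
  simp only [oGy_apply]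
  exact sum_congr rfl fun _ _ => by ring

theorem oNy_oGy (p : STF n) : oNy n (oGy n p) = oGy n (oNy n p) + (2 : ℝ) • oGy n p := by
  rw [oNy_apply p]
  simp only [oNy_apply (oGy n p), pderiv_inr_oGy, mul_add, sum_add_distrib, map_sum]
  rw [add_comm]
  congr 1
  · simp only [oGy_apply]
    exact sum_congr rfl fun _ _ => by ring
  · simp only [oGy_apply, mul_smul_comm, ← smul_sum, sum_mul]
    congr 1
    exact sum_congr rfl fun _ _ => by ring

theorem oNy_oTry (p : STF n) : oNy n (oTry n p) = oTry n (oNy n p) - (2 : ℝ) • oTry n p := by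
  simp only [oTry_apply, pderiv_inr_oNy, map_add, map_sum, sum_add_distrib, two_smul]
  abel

theorem oNy_oDiv (p : STF n) : oNy n (oDiv n p) = oDiv n (oNy n p) - oDiv n p := by
  simp only [oDiv_apply, pderiv_inr_oNy, pderiv_inl_oNy, map_sum, sum_add_distrib]
  abel

theorem oNy_oGrad (p : STF n) : oNy n (oGrad n p) = oGrad n (oNy n p) + oGrad n p := by
  simp only [oGrad_apply, pderiv_inl_oNy, map_sum, oNy_X_mul, sum_add_distrib]
  abel

theorem oNy_monomial (m : Fin n ⊕ Fin n →₀ ℕ) (c : ℝ) :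
    oNy n (monomial m c) = ((∑ μ, m (Sum.inr μ) : ℕ) : ℝ) • monomial m c := by
  simp only [oNy_apply, X_mul_pderiv_monomial, Nat.cast_smul_eq_nsmul, sum_smul]

theorem coeff_oNy (m : Fin n ⊕ Fin n →₀ ℕ) (p : STF n) :
    coeff m (oNy n p) = ((∑ μ, m (Sum.inr μ) : ℕ) : ℝ) * coeff m p := by
  induction p using MvPolynomial.induction_on' with
  | monomial u a =>
    rw [oNy_monomial, coeff_smul, smul_eq_mul, coeff_monomial]
    split_ifs with h
    · rw [h]
    · simp
  | add p q hp hq => rw [map_add, coeff_add, coeff_add, hp, hq, mul_add]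

theorem eq_zero_of_oNy_neg {r : ℝ} (hr : r < 0) {p : STF n} (hp : oNy n p = r • p) : p = 0 := by
  ext m
  have h := congrArg (coeff m) hp
  rw [coeff_oNy, coeff_smul, smul_eq_mul, ← sub_eq_zero, ← sub_mul, mul_eq_zero] at h
  rcases h with h | h
  · have : (0 : ℝ) ≤ ((∑ μ, m (Sum.inr μ) : ℕ) : ℝ) := Nat.cast_nonneg _
    linarith
  · simpa using h

/-- Fiberwise harmonic tensor fields, homogeneous of degree `s` in `y`. -/
def IsFiberHarmonic (s : ℕ) (φ : STF n) : Prop :=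
  oNy n φ = (s : ℝ) • φ ∧ oTry n φ = 0

theorem oGy_pow_succ_apply (k : ℕ) (p : STF n) :
    (oGy n ^ (k + 1)) p = oGy n ((oGy n ^ k) p) := by
  rw [pow_succ', Module.End.mul_apply]

theorem oNy_oGy_pow {s : ℕ} {φ : STF n} (hφ : IsFiberHarmonic s φ) (k : ℕ) :
    oNy n ((oGy n ^ k) φ) = (s + 2 * k : ℝ) • (oGy n ^ k) φ := by
  induction k with
  | zero => simpa using hφ.1
  | succ k ih =>
    rw [oGy_pow_succ_apply, oNy_oGy, ih]
    push_cast
    simp only [map_smul]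
    module

theorem oTry_oGy_pow_succ {s : ℕ} {φ : STF n} (hφ : IsFiberHarmonic s φ) (k : ℕ) :
    oTry n ((oGy n ^ (k + 1)) φ) = (2 * (k + 1) * (2 * s + 2 * k + n) : ℝ) • (oGy n ^ k) φ := by
  induction k with
  | zero =>
    simp only [zero_add, pow_one, pow_zero, Module.End.one_apply]
    rw [oTry_oGy, hφ.1, hφ.2, map_zero]
    push_cast
    module
  | succ k ih =>
    rw [oGy_pow_succ_apply, oTry_oGy, ih, oNy_oGy_pow hφ, map_smul, ← oGy_pow_succ_apply]
    push_cast
    module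

theorem oGrad_oGy_pow (k : ℕ) (p : STF n) :
    oGrad n ((oGy n ^ k) p) = (oGy n ^ k) (oGrad n p) := by
  induction k with
  | zero => simp
  | succ k ih => rw [oGy_pow_succ_apply, oGrad_oGy, ih, oGy_pow_succ_apply]

theorem oDiv_oGy_pow_succ (k : ℕ) (p : STF n) :
    oDiv n ((oGy n ^ (k + 1)) p)
      = (oGy n ^ (k + 1)) (oDiv n p) + (2 * (k + 1) : ℝ) • (oGy n ^ k) (oGrad n p) := by
  induction k with
  | zero =>
    simp only [zero_add, pow_one, pow_zero, Module.End.one_apply]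
    rw [oDiv_oGy]
    push_cast
    module
  | succ k ih =>
    rw [oGy_pow_succ_apply, oDiv_oGy, ih, oGrad_oGy_pow, map_add, map_smul,
      oGy_pow_succ_apply (k + 1), oGy_pow_succ_apply k (oGrad n p)]
    push_cast
    module

/-- Existence of the fiberwise Fischer decomposition on tensor fields of degree `d` in `y`. -/
theorem mem_span_oGy_pow (hn : 0 < n) (d : ℕ) (p : STF n) (hp : oNy n p = (d : ℝ) • p) :
    p ∈ Submodule.span ℝ
      {v | ∃ s k φ, s + 2 * k = d ∧ IsFiberHarmonic s φ ∧ v = (oGy n ^ k) φ} := by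
  induction d using Nat.strong_induction_on generalizing p with
  | _ d ih =>
  have hN : oNy n (oTry n p) = ((d : ℝ) - 2) • oTry n p := by
    rw [oNy_oTry, hp, map_smul]; module
  rcases lt_or_ge d 2 with hd | hd
  · have hr : (d : ℝ) - 2 < 0 := by
      have : (d : ℝ) < 2 := by exact_mod_cast hd
      linarith
    exact Submodule.subset_span
      ⟨d, 0, p, by simp, ⟨hp, eq_zero_of_oNy_neg hr hN⟩, by simp⟩
  · obtain ⟨e, rfl⟩ := Nat.exists_eq_add_of_le' hd
    have ht := ih e (by omega) (oTry n p) (by rw [hN]; push_cast; congr 1; ring)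
    have key : ∀ w ∈ Submodule.span ℝ
        {v : STF n | ∃ s k φ, s + 2 * k = e ∧ IsFiberHarmonic s φ ∧ v = (oGy n ^ k) φ},
        ∃ q ∈ Submodule.span ℝ
          {v : STF n | ∃ s k φ, s + 2 * k = e + 2 ∧ IsFiberHarmonic s φ ∧ v = (oGy n ^ k) φ},
          oNy n q = ((e + 2 : ℕ) : ℝ) • q ∧ oTry n q = w := by
      intro w hw
      induction hw using Submodule.span_induction with
      | mem w hw =>
        obtain ⟨s, k, φ, hsk, hφ, rfl⟩ := hw
        have hc : (2 * (k + 1) * (2 * s + 2 * k + n) : ℝ) ≠ 0 := by positivity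
        refine ⟨(2 * (k + 1) * (2 * s + 2 * k + n) : ℝ)⁻¹ • (oGy n ^ (k + 1)) φ,
          Submodule.smul_mem _ _ (Submodule.subset_span ⟨s, k + 1, φ, by omega, hφ, rfl⟩), ?_, ?_⟩
        · rw [map_smul, oNy_oGy_pow hφ, ← hsk, smul_comm]
          push_cast
          congr 1
          ring
        · rw [map_smul, oTry_oGy_pow_succ hφ, smul_smul, inv_mul_cancel₀ hc, one_smul]
      | zero => exact ⟨0, Submodule.zero_mem _, by simp, by simp⟩
      | add x y _ _ hx hy =>
        obtain ⟨q, hq, hq1, hq2⟩ := hx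
        obtain ⟨r, hr, hr1, hr2⟩ := hy
        exact ⟨q + r, Submodule.add_mem _ hq hr, by rw [map_add, hq1, hr1, smul_add],
          by rw [map_add, hq2, hr2]⟩
      | smul a x _ hx =>
        obtain ⟨q, hq, hq1, hq2⟩ := hx
        exact ⟨a • q, Submodule.smul_mem _ _ hq, by rw [map_smul, hq1, smul_comm],
          by rw [map_smul, hq2]⟩
    obtain ⟨q, hq, hq1, hq2⟩ := key _ ht
    rw [← sub_add_cancel p q]
    refine Submodule.add_mem _ (Submodule.subset_span ⟨e + 2, 0, p - q, by simp, ⟨?_, ?_⟩, by simp⟩)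
      hq
    · rw [map_sub, hp, hq1, smul_sub]
    · rw [map_sub, hq2, sub_self]

/-- Linear maps agreeing on all powers of `g` times fiberwise harmonic fields are equal. -/
theorem end_ext_fiberHarmonic (hn : 0 < n) {S T : Module.End ℝ (STF n)}
    (h : ∀ s k φ, IsFiberHarmonic s φ → S ((oGy n ^ k) φ) = T ((oGy n ^ k) φ)) : S = T := by
  refine MvPolynomial.linearMap_ext fun m => LinearMap.ext fun c => ?_
  change S (monomial m c) = T (monomial m c)
  refine (LinearMap.eqOn_span (f := S) (g := T) ?_) (mem_span_oGy_pow hn _ _ (oNy_monomial m c))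
  rintro _ ⟨s, k, φ, -, hφ, rfl⟩
  exact h s k φ hφ

/-- The gradient of a harmonic field splits as `a + g b` with `a`, `b` harmonic and `b`
proportional to the divergence. -/
theorem exists_oGrad_eq (hn : 2 < n) {s : ℕ} {φ : STF n} (hφ : IsFiberHarmonic s φ) :
    ∃ a b : STF n, IsFiberHarmonic (s + 1) a ∧ (b = 0 ∨ ∃ t, s = t + 1 ∧ IsFiberHarmonic t b) ∧
      oGrad n φ = a + oGy n b ∧ oDiv n φ = (2 * s + n - 2 : ℝ) • b := by
  have hn' : (2 : ℝ) < n := by exact_mod_cast hn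
  have hs : (0 : ℝ) ≤ s := Nat.cast_nonneg s
  have hc : (2 * s + n - 2 : ℝ) ≠ 0 := by linarith
  have hN : oNy n (oDiv n φ) = (s - 1 : ℝ) • oDiv n φ := by
    rw [oNy_oDiv, hφ.1, map_smul]; module
  obtain ⟨b, hb⟩ : ∃ b, oDiv n φ = (2 * s + n - 2 : ℝ) • b :=
    ⟨(2 * s + n - 2 : ℝ)⁻¹ • oDiv n φ, by rw [smul_smul, mul_inv_cancel₀ hc, one_smul]⟩
  have hbN : oNy n b = (s - 1 : ℝ) • b := by
    rw [hb, map_smul, smul_comm] at hN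
    exact smul_right_injective _ hc hN
  have hbT : oTry n b = 0 := by
    have h := oTry_oDiv φ
    rw [hφ.2, map_zero, hb, map_smul] at h
    exact (smul_eq_zero.mp h).resolve_left hc
  refine ⟨oGrad n φ - oGy n b, b, ⟨?_, ?_⟩, ?_, (sub_add_cancel _ _).symm, hb⟩
  · rw [map_sub, oNy_oGrad, oNy_oGy, hφ.1, hbN, map_smul, map_smul]
    push_cast
    module
  · rw [map_sub, oTry_oGrad, oTry_oGy, hφ.2, hbN, hbT, hb, map_zero, map_zero]
    module
  · rcases s with _ | t
    · exact Or.inl (eq_zero_of_oNy_neg (by norm_num) hbN)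
    · exact Or.inr ⟨t, rfl, by rw [hbN]; push_cast; congr 1; ring, hbT⟩

end FiberOperators

/-- the further reordering identities
`tr∘grad~ = ((𝒩+𝒞+1)(𝒩+𝒞−3)/(𝒩+𝒞−1)²)∘grad~∘tr` and
`div~∘g = g∘div~∘((𝒩+𝒞+1)(𝒩+𝒞−3)/(𝒩+𝒞−1)²)`, realized via the inverse `E` of
`𝒩+𝒞−1`. -/
theorem stmt16 (n : ℕ) (hn : 4 ≤ n)
    (C E : Module.End ℝ (STF n))
    (hC : ∀ (s k : ℕ) (φ : STF n), oNy n φ = (s : ℝ) • φ → oTry n φ = 0 →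
      C ((oGy n ^ k) φ) = ((s : ℝ) + ((n : ℝ) - 2) / 2) • (oGy n ^ k) φ)
    (hE : (oNy n + ((n : ℝ) / 2) • 1 + C - 1) * E = 1 ∧
          E * (oNy n + ((n : ℝ) / 2) • 1 + C - 1) = 1) :
    let NN : Module.End ℝ (STF n) := oNy n + ((n : ℝ) / 2) • 1
    let gradT : Module.End ℝ (STF n) := oGrad n - oGy n * oDiv n * E
    let divT : Module.End ℝ (STF n) := oDiv n - E * oGrad n * oTry n
    let ratio : Module.End ℝ (STF n) := (NN + C + 1) * (NN + C - 3) * E * E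
    oTry n * gradT = ratio * gradT * oTry n ∧
    divT * oGy n = oGy n * divT * ratio := by
  intro NN gradT divT ratio
  have hn4 : (4 : ℝ) ≤ n := by exact_mod_cast hn
  have hT : ∀ {s : ℕ} (k : ℕ) {φ : STF n}, IsFiberHarmonic s φ →
      (NN + C) ((oGy n ^ k) φ) = (2 * s + 2 * k + n - 1 : ℝ) • (oGy n ^ k) φ := by
    intro s k φ hφ
    simp only [NN, LinearMap.add_apply, LinearMap.smul_apply, Module.End.one_apply,
      hC s k φ hφ.1 hφ.2, oNy_oGy_pow hφ]
    module
  have hEv : ∀ {s : ℕ} (k : ℕ) {φ : STF n}, IsFiberHarmonic s φ →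
      E ((oGy n ^ k) φ) = (2 * s + 2 * k + n - 2 : ℝ)⁻¹ • (oGy n ^ k) φ := by
    intro s k φ hφ
    have hM : (2 * s + 2 * k + n - 2 : ℝ) ≠ 0 := by
      have : (0 : ℝ) ≤ 2 * s + 2 * k := by positivity
      linarith
    have h := LinearMap.congr_fun hE.2 ((oGy n ^ k) φ)
    have hv : (NN + C - 1) ((oGy n ^ k) φ) = (2 * s + 2 * k + n - 2 : ℝ) • (oGy n ^ k) φ := by
      rw [LinearMap.sub_apply, hT k hφ, Module.End.one_apply]; module
    change E ((NN + C - 1) ((oGy n ^ k) φ)) = _ at h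
    rw [eq_inv_smul_iff₀ hM, ← map_smul, ← hv, h, Module.End.one_apply]
  have hR : ∀ {s : ℕ} (k : ℕ) {φ : STF n}, IsFiberHarmonic s φ →
      ratio ((oGy n ^ k) φ) = ((2 * s + 2 * k + n) * (2 * s + 2 * k + n - 4) *
        (2 * s + 2 * k + n - 2 : ℝ)⁻¹ * (2 * s + 2 * k + n - 2 : ℝ)⁻¹) • (oGy n ^ k) φ := by
    intro s k φ hφ
    have h3 : (3 : Module.End ℝ (STF n)) ((oGy n ^ k) φ) = (3 : ℝ) • (oGy n ^ k) φ := by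
      rw [Module.End.ofNat_apply, ← Nat.cast_smul_eq_nsmul ℝ, Nat.cast_ofNat]
    have hp : (NN + C + 1) ((oGy n ^ k) φ) = (2 * s + 2 * k + n : ℝ) • (oGy n ^ k) φ := by
      rw [LinearMap.add_apply, hT k hφ, Module.End.one_apply]; module
    have hm : (NN + C - 3) ((oGy n ^ k) φ) = (2 * s + 2 * k + n - 4 : ℝ) • (oGy n ^ k) φ := by
      rw [LinearMap.sub_apply, hT k hφ, h3]; module
    simp only [ratio, Module.End.mul_apply, hEv k hφ, map_smul, hm, hp, smul_smul]
    congr 1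
    ring
  have hgrad : ∀ {s : ℕ} (k : ℕ) {φ a b : STF n}, IsFiberHarmonic s φ →
      oGrad n φ = a + oGy n b → oDiv n φ = (2 * s + n - 2 : ℝ) • b →
      gradT ((oGy n ^ k) φ)
        = ((2 * s + n - 2) * (2 * s + 2 * k + n - 2 : ℝ)⁻¹) • (oGy n ^ k) a := by
    intro s k φ a b hφ hg hd
    have hM : (2 * s + 2 * k + n - 2 : ℝ) ≠ 0 := by
      have : (0 : ℝ) ≤ 2 * s + 2 * k := by positivity
      linarith
    have hgb : ∀ k, (oGy n ^ k) (oGy n b) = oGy n ((oGy n ^ k) b) := fun k => by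
      rw [← oGy_pow_succ_apply, pow_succ, Module.End.mul_apply]
    simp only [gradT, LinearMap.sub_apply, Module.End.mul_apply, hEv k hφ, map_smul, oGrad_oGy_pow]
    rcases k with _ | k
    · simp only [pow_zero, Module.End.one_apply, hg, hd, map_smul]
      have hM1 := mul_inv_cancel₀ hM
      match_scalars
      · linear_combination -hM1
      · linear_combination -hM1
    · rw [oDiv_oGy_pow_succ, hg, hd]
      simp only [map_add, map_smul, hgb, oGy_pow_succ_apply]
      have hM1 := mul_inv_cancel₀ hM
      push_cast at hM1 ⊢
      match_scalars
      · linear_combination -hM1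
      · linear_combination -hM1
  have hdiv : ∀ {s : ℕ} (k : ℕ) {φ a b : STF n}, IsFiberHarmonic s φ →
      IsFiberHarmonic (s + 1) a → (b = 0 ∨ ∃ t, s = t + 1 ∧ IsFiberHarmonic t b) →
      oGrad n φ = a + oGy n b → oDiv n φ = (2 * s + n - 2 : ℝ) • b →
      divT ((oGy n ^ k) φ)
        = ((2 * s + 2 * k + n - 2) * (2 * s + n - 4) * (2 * s + 2 * k + n - 4 : ℝ)⁻¹) •
          (oGy n ^ k) b := by
    intro s k φ a b hφ ha hb hg hd
    rcases hb with rfl | ⟨t, rfl, hb⟩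
    · rcases k with _ | k
      · simp [divT, hφ.2, hd]
      · have hM : (2 * s + 2 * k + n : ℝ) ≠ 0 := by positivity
        have h := hEv k ha
        have hM' : (2 * (s + 1 : ℕ) + 2 * k + n - 2 : ℝ) = 2 * s + 2 * k + n := by push_cast; ring
        rw [hM'] at h
        simp only [divT, LinearMap.sub_apply, Module.End.mul_apply, oTry_oGy_pow_succ hφ,
          oDiv_oGy_pow_succ, map_smul, oGrad_oGy_pow, hd, hg, map_zero, add_zero, smul_zero, h]
        match_scalars
        field_simp
        ring
    · rcases k with _ | k
      · have hM : (2 * t + n - 2 : ℝ) ≠ 0 := by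
          have : (0 : ℝ) ≤ 2 * t := by positivity
          linarith
        simp only [divT, LinearMap.sub_apply, Module.End.mul_apply, pow_zero, Module.End.one_apply,
          hφ.2, hd, map_zero, sub_zero]
        congr 1
        push_cast
        have h1 : (2 * (t + 1) + n - 4 : ℝ) = 2 * t + n - 2 := by ring
        rw [mul_zero, add_zero, h1]
        field_simp
      · have hM : (2 * (t + 1) + 2 * k + n : ℝ) ≠ 0 := by positivity
        have hM2 : (2 * t + 2 * k + n : ℝ) ≠ 0 := by positivity
        have h := hEv k ha
        have hM' : (2 * (t + 1 + 1 : ℕ) + 2 * k + n - 2 : ℝ) = 2 * (t + 1) + 2 * k + n := by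
          push_cast; ring
        rw [hM'] at h
        have h' := hEv (k + 1) hb
        have hM2' : (2 * t + 2 * (k + 1 : ℕ) + n - 2 : ℝ) = 2 * t + 2 * k + n := by
          push_cast; ring
        rw [hM2'] at h'
        have hgb : (oGy n ^ k) (oGy n b) = (oGy n ^ (k + 1)) b := by
          rw [pow_succ, Module.End.mul_apply]
        have hM3 : (2 * (t + 1) + 2 * (k + 1) + n - 4 : ℝ) = 2 * t + 2 * k + n := by ring
        simp only [divT, LinearMap.sub_apply, Module.End.mul_apply, oTry_oGy_pow_succ hφ,
          oDiv_oGy_pow_succ, map_smul, map_add, oGrad_oGy_pow, hd, hg, hgb, h, h']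
        push_cast
        rw [hM3]
        match_scalars <;> field_simp <;> ring
  refine ⟨end_ext_fiberHarmonic (by omega) fun s k φ hφ => ?_,
    end_ext_fiberHarmonic (by omega) fun s k φ hφ => ?_⟩
  · obtain ⟨a, b, ha, hb, hg, hd⟩ := exists_oGrad_eq (by omega) hφ
    rw [Module.End.mul_apply, Module.End.mul_apply, Module.End.mul_apply, hgrad k hφ hg hd]
    rcases k with _ | k
    · simp [hφ.2, ha.2]
    · have hM1 : (2 * s + 2 * k + n : ℝ) ≠ 0 := by positivity
      have hM2 : (2 * (s + k) + n - 2 : ℝ) ≠ 0 := by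
        have : (0 : ℝ) ≤ 2 * (s + k) := by positivity
        linarith
      have e1 : (2 * s + 2 * (k + 1) + n - 2 : ℝ) = 2 * s + 2 * k + n := by ring
      have e2 : (2 * (s + 1) + 2 * k + n - 2 : ℝ) = 2 * s + 2 * k + n := by ring
      have e3 : (2 * (s + 1) + 2 * k + n - 4 : ℝ) = 2 * s + 2 * k + n - 2 := by ring
      rw [map_smul, oTry_oGy_pow_succ ha, oTry_oGy_pow_succ hφ, map_smul, map_smul, hgrad k hφ hg hd,
        map_smul, hR k ha]
      simp only [smul_smul]
      push_cast
      rw [e1, e2, e3]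
      congr 1
      field_simp
  · obtain ⟨a, b, ha, hb, hg, hd⟩ := exists_oGrad_eq (by omega) hφ
    rw [Module.End.mul_apply, Module.End.mul_apply, Module.End.mul_apply, hR k hφ,
      ← oGy_pow_succ_apply, hdiv (k + 1) hφ ha hb hg hd, map_smul, map_smul,
      hdiv k hφ ha hb hg hd, map_smul, ← oGy_pow_succ_apply, smul_smul]
    rcases hb with rfl | ⟨t, rfl, hb⟩
    · simp
    · have hM1 : (2 * t + 2 * k + n : ℝ) ≠ 0 := by positivity
      have hM2 : (2 * (t + k) + n - 2 : ℝ) ≠ 0 := by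
        have : (0 : ℝ) ≤ 2 * (t + k) := by positivity
        linarith
      congr 1
      push_cast
      have e1 : (2 * (t + 1) + 2 * (k + 1) + n - 4 : ℝ) = 2 * t + 2 * k + n := by ring
      have e2 : (2 * (t + 1) + 2 * k + n - 2 : ℝ) = 2 * t + 2 * k + n := by ring
      have e3 : (2 * (t + 1) + 2 * k + n - 4 : ℝ) = 2 * t + 2 * k + n - 2 := by ring
      have e4 : (2 * (t + 1) + 2 * (k + 1) + n - 2 : ℝ) = 2 * (t + 1) + 2 * k + n := by ring
      rw [e1, e2, e3, e4]
      field_simp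
end
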